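/- Let 1/3 < γ ≤ 1/2, T > 0. Let b ∈ L^∞([0,T]; C^1_b(ℝ^d;ℝ^d)), let X, Y ∈ C^γ([0,T];ℝ^d) with X_0 = Y_0 = 0, let Φ^X, Φ^Y be the unique flows of Φ_t(x) = x + ∫_0^t b_r(Φ_r(x)) dr + X_t (respectively with Y), and let φ ∈ C^3(ℝ^d;ℝ) with compact support. Then there exist a constant C, depending only on T, sup_t‖b_t‖_∞, sup_t‖Db_t‖_∞, ‖φ‖_∞, ‖Dφ‖_∞, ‖D²φ‖_∞, ‖D³φ‖_∞ and nondecreasing in each, and a radius R, depending only on T, sup_t‖b_t‖_∞, ‖X‖_γ, ‖Y‖_γ and the support of φ and nondecreasing in each, such that for all x ∈ ℝ^d: (i) the γ-Hölder seminorm of t ↦ Dφ(Φ^X_t(x)) − Dφ(Φ^Y_t(x)) is at most C ‖X−Y‖_γ (1+‖X‖_γ)(1+‖Y‖_γ) · 1_{B(0,R)}(x); and (ii) with R^X_{s,t} := φ(Φ^X_t(x)) − φ(Φ^X_s(x)) − Dφ(Φ^X_s(x))(X_t − X_s) and R^Y_{s,t} defined analogously with Y, one has sup_{s≠t∈[0,T]}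 |R^X_{s,t} − R^Y_{s,t}|/|t−s|^{2γ} ≤ C ‖X−Y‖_γ (1+‖X‖_γ)(1+‖Y‖_γ) · 1_{B(0,R)}(x). -/

import Mathlib

open MeasureTheory Set Function

noncomputable section

abbrev Euc (d : ℕ) : Type := EuclideanSpace ℝ (Fin d)

section FourPoint

variable {E F : Type*} [NormedAddCommGroup E] [NormedSpace ℝ E]
  [NormedAddCommGroup F] [NormedSpace ℝ F]

/-- Four-point inequality for a map with bounded and Lipschitz derivative. -/
lemma norm_sub_sub_sub_le_of_lipschitz_fderiv {f : E → F} {M N : ℝ}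
    (hf : Differentiable ℝ f) (hM : ∀ x, ‖fderiv ℝ f x‖ ≤ M)
    (hN : ∀ x y, ‖fderiv ℝ f x - fderiv ℝ f y‖ ≤ N * ‖x - y‖) (hN0 : 0 ≤ N) (a a' c c' : E) :
    ‖(f a' - f c') - (f a - f c)‖ ≤
      M * ‖(a' - a) - (c' - c)‖ + N * (‖a' - a‖ + ‖c' - c‖) * ‖a - c‖ := by
  have hd : ∀ (u v : E) (θ : ℝ), HasDerivAt (fun θ : ℝ => f (u + θ • v))
      (fderiv ℝ f (u + θ • v) v) θ := fun u v θ => by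
    have h1 : HasDerivAt (fun θ : ℝ => u + θ • v) v θ := by
      simpa using ((hasDerivAt_id θ).smul_const v).const_add u
    exact (hf (u + θ • v)).hasFDerivAt.comp_hasDerivAt θ h1
  have key := norm_image_sub_le_of_norm_deriv_le_segment_01'
    (f := fun θ : ℝ => f (c' + θ • (a' - c')) - f (c + θ • (a - c)))
    (C := M * ‖(a' - a) - (c' - c)‖ + N * (‖a' - a‖ + ‖c' - c‖) * ‖a - c‖)
    (fun θ _ => ((hd c' (a' - c') θ).sub (hd c (a - c) θ)).hasDerivWithinAt)
    (fun θ hθ => by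
      have e : fderiv ℝ f (c' + θ • (a' - c')) (a' - c') - fderiv ℝ f (c + θ • (a - c)) (a - c)
          = fderiv ℝ f (c' + θ • (a' - c')) ((a' - a) - (c' - c))
            + (fderiv ℝ f (c' + θ • (a' - c')) - fderiv ℝ f (c + θ • (a - c))) (a - c) := by
        simp only [map_sub, sub_apply]
        abel
      rw [e]
      refine (norm_add_le _ _).trans (add_le_add ?_ ?_)
      · exact ((fderiv ℝ f _).le_opNorm _).trans
          (mul_le_mul_of_nonneg_right (hM _) (norm_nonneg _))
      · refine (ContinuousLinearMap.le_opNorm _ _).trans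
          (mul_le_mul_of_nonneg_right ((hN _ _).trans ?_) (norm_nonneg _))
        refine mul_le_mul_of_nonneg_left ?_ hN0
        have e2 : c' + θ • (a' - c') - (c + θ • (a - c)) =
            θ • (a' - a) + (1 - θ) • (c' - c) := by module
        rw [e2]
        refine (norm_add_le _ _).trans (add_le_add ?_ ?_)
        · rw [norm_smul, Real.norm_of_nonneg hθ.1]
          exact mul_le_of_le_one_left (norm_nonneg _) hθ.2.le
        · rw [norm_smul, Real.norm_of_nonneg (by linarith [hθ.2])]
          exact mul_le_of_le_one_left (norm_nonneg _) (by linarith [hθ.1]))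
  rw [sub_sub_sub_comm]
  simpa using key

/-- Comparison of first-order Taylor remainders; one-sided version. -/
lemma norm_taylor_sub_taylor_le_aux {f : E → F} {M N : ℝ}
    (hf : Differentiable ℝ f) (hf' : Differentiable ℝ (fderiv ℝ f))
    (hM : ∀ x, ‖fderiv ℝ (fderiv ℝ f) x‖ ≤ M)
    (hN : ∀ x y, ‖fderiv ℝ (fderiv ℝ f) x - fderiv ℝ (fderiv ℝ f) y‖ ≤ N * ‖x - y‖)
    (hM0 : 0 ≤ M) (hN0 : 0 ≤ N) (a c h k : E) :
    ‖(f (a + h) - f a - fderiv ℝ f a h) - (f (c + k) - f c - fderiv ℝ f c k)‖ ≤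
      M * ‖h - k‖ * (‖h‖ + ‖k‖) + N * (‖h‖ + ‖k‖) * ‖a - c‖ * ‖h‖ := by
  have hd : ∀ (u v : E) (θ : ℝ), HasDerivAt (fun θ : ℝ => f (u + θ • v) - θ • fderiv ℝ f u v)
      (fderiv ℝ f (u + θ • v) v - fderiv ℝ f u v) θ := fun u v θ => by
    have h1 : HasDerivAt (fun θ : ℝ => u + θ • v) v θ := by
      simpa using ((hasDerivAt_id θ).smul_const v).const_add u
    have h2 : HasDerivAt (fun θ : ℝ => θ • fderiv ℝ f u v) (fderiv ℝ f u v) θ := by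
      simpa using (hasDerivAt_id θ).smul_const (fderiv ℝ f u v)
    exact ((hf (u + θ • v)).hasFDerivAt.comp_hasDerivAt θ h1).sub h2
  have hlip : ∀ x y, ‖fderiv ℝ f x - fderiv ℝ f y‖ ≤ M * ‖x - y‖ := fun x y =>
    convex_univ.norm_image_sub_le_of_norm_fderiv_le (fun z _ => hf' z) (fun z _ => hM z)
      (mem_univ y) (mem_univ x)
  have key := norm_image_sub_le_of_norm_deriv_le_segment_01'
    (f := fun θ : ℝ => (f (a + θ • h) - θ • fderiv ℝ f a h) - (f (c + θ • k) - θ • fderiv ℝ f c k))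
    (C := M * ‖h - k‖ * (‖h‖ + ‖k‖) + N * (‖h‖ + ‖k‖) * ‖a - c‖ * ‖h‖)
    (fun θ _ => ((hd a h θ).sub (hd c k θ)).hasDerivWithinAt)
    (fun θ hθ => by
      have e : fderiv ℝ f (a + θ • h) h - fderiv ℝ f a h
            - (fderiv ℝ f (c + θ • k) k - fderiv ℝ f c k)
          = ((fderiv ℝ f (a + θ • h) - fderiv ℝ f (c + θ • k))
              - (fderiv ℝ f a - fderiv ℝ f c)) h
            + (fderiv ℝ f (c + θ • k) - fderiv ℝ f c) (h - k) := by
        simp only [map_sub, sub_apply]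
        abel
      have n1 : ∀ v : E, ‖θ • v‖ ≤ ‖v‖ := fun v => by
        rw [norm_smul, Real.norm_of_nonneg hθ.1]
        exact mul_le_of_le_one_left (norm_nonneg _) hθ.2.le
      have b1 : ‖(fderiv ℝ f (a + θ • h) - fderiv ℝ f (c + θ • k))
              - (fderiv ℝ f a - fderiv ℝ f c)‖ ≤
            M * ‖h - k‖ + N * (‖h‖ + ‖k‖) * ‖a - c‖ := by
        refine (norm_sub_sub_sub_le_of_lipschitz_fderiv hf' hM hN hN0 _ _ _ _).trans ?_
        simp only [add_sub_cancel_left, ← smul_sub]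
        gcongr <;> exact n1 _
      have b2 : ‖fderiv ℝ f (c + θ • k) - fderiv ℝ f c‖ ≤ M * ‖k‖ := by
        refine (hlip _ _).trans ?_
        simp only [add_sub_cancel_left]
        gcongr
        exact n1 _
      rw [e]
      calc _ ≤ (M * ‖h - k‖ + N * (‖h‖ + ‖k‖) * ‖a - c‖) * ‖h‖ + M * ‖k‖ * ‖h - k‖ := by
            refine (norm_add_le _ _).trans (add_le_add ?_ ?_)
            · exact (ContinuousLinearMap.le_opNorm _ _).trans
                (mul_le_mul_of_nonneg_right b1 (norm_nonneg _))
            · exact (ContinuousLinearMap.le_opNorm _ _).trans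
                (mul_le_mul_of_nonneg_right b2 (norm_nonneg _))
        _ = _ := by ring)
  convert key using 2
  simp only [one_smul, zero_smul, add_zero, sub_zero]
  abel

/-- Comparison of first-order Taylor remainders. -/
lemma norm_taylor_sub_taylor_le {f : E → F} {M N : ℝ}
    (hf : Differentiable ℝ f) (hf' : Differentiable ℝ (fderiv ℝ f))
    (hM : ∀ x, ‖fderiv ℝ (fderiv ℝ f) x‖ ≤ M)
    (hN : ∀ x y, ‖fderiv ℝ (fderiv ℝ f) x - fderiv ℝ (fderiv ℝ f) y‖ ≤ N * ‖x - y‖)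
    (hM0 : 0 ≤ M) (hN0 : 0 ≤ N) (a c h k : E) :
    ‖(f (a + h) - f a - fderiv ℝ f a h) - (f (c + k) - f c - fderiv ℝ f c k)‖ ≤
      M * ‖h - k‖ * (‖h‖ + ‖k‖) + 2 * N * ‖a - c‖ * (‖h‖ * ‖k‖) := by
  have aux : ∀ x y z : ℝ, 0 ≤ x → x ≤ y → 0 ≤ z → N * (x + y) * z * x ≤ 2 * N * z * (x * y) := by
    intro x y z hx hxy hz
    have := mul_nonneg (mul_nonneg (mul_nonneg hN0 hz) hx) (sub_nonneg.2 hxy)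
    nlinarith
  rcases le_total ‖h‖ ‖k‖ with hk | hk
  · refine (norm_taylor_sub_taylor_le_aux hf hf' hM hN hM0 hN0 a c h k).trans ?_
    linarith [aux ‖h‖ ‖k‖ ‖a - c‖ (norm_nonneg _) hk (norm_nonneg _)]
  · rw [norm_sub_rev]
    refine (norm_taylor_sub_taylor_le_aux hf hf' hM hN hM0 hN0 c a k h).trans ?_
    rw [norm_sub_rev k h, norm_sub_rev c a, add_comm ‖k‖, mul_comm ‖h‖ ‖k‖]
    have := aux ‖k‖ ‖h‖ ‖a - c‖ (norm_nonneg _) hk (norm_nonneg _)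
    rw [add_comm ‖k‖] at this
    linarith

lemma norm_sub_le_of_norm_iteratedFDeriv_one_le {g : E → F} {N : ℝ} (hg : ContDiff ℝ 1 g)
    (hN : ∀ x, ‖iteratedFDeriv ℝ 1 g x‖ ≤ N) (x y : E) : ‖g x - g y‖ ≤ N * ‖x - y‖ :=
  convex_univ.norm_image_sub_le_of_norm_fderiv_le
    (fun w _ => hg.differentiable (by norm_num) w)
    (fun w _ => by rw [← norm_iteratedFDeriv_one]; exact hN w) (mem_univ y) (mem_univ x)

end FourPoint

/-- Grönwall's inequality in integral form. -/
lemma le_mul_exp_of_le_add_integral {u : ℝ → ℝ} {A K T : ℝ} (hA : 0 ≤ A) (hK : 0 ≤ K)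
    (hu : ContinuousOn u (Icc 0 T)) (hu0 : ∀ t ∈ Icc 0 T, 0 ≤ u t)
    (h : ∀ t ∈ Icc 0 T, u t ≤ A + K * ∫ r in (0:ℝ)..t, u r) :
    ∀ t ∈ Icc 0 T, u t ≤ A * Real.exp (K * t) := by
  intro t ht
  have hT : 0 ≤ T := ht.1.trans ht.2
  set g : ℝ → ℝ := IccExtend hT (domRestrict (Icc 0 T) u) with hg
  have hgc : Continuous g := (continuousOn_iff_continuous_domRestrict.1 hu).Icc_extend'
  have hgu : ∀ r ∈ Icc 0 T, g r = u r := fun r hr => by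
    rw [hg, IccExtend_of_mem hT _ hr]; rfl
  have hint : ∀ r ∈ Icc 0 T, ∫ z in (0:ℝ)..r, u z = ∫ z in (0:ℝ)..r, g z := fun r hr =>
    intervalIntegral.integral_congr fun z hz => by
      rw [uIcc_of_le hr.1] at hz
      exact (hgu z ⟨hz.1, hz.2.trans hr.2⟩).symm
  have hder : ∀ r : ℝ, HasDerivAt (fun r => A + K * ∫ z in (0:ℝ)..r, g z) (K * g r) r := fun r =>
    ((hgc.integral_hasStrictDerivAt 0 r).hasDerivAt.const_mul K).const_add A
  have hnn : ∀ r ∈ Icc 0 T, 0 ≤ ∫ z in (0:ℝ)..r, g z := fun r hr =>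
    intervalIntegral.integral_nonneg hr.1 fun z hz => by
      rw [hgu z ⟨hz.1, hz.2.trans hr.2⟩]
      exact hu0 z ⟨hz.1, hz.2.trans hr.2⟩
  have hle : ∀ r ∈ Icc 0 T, u r ≤ A + K * ∫ z in (0:ℝ)..r, g z := fun r hr => by
    rw [← hint r hr]; exact h r hr
  have key := norm_le_gronwallBound_of_norm_deriv_right_le (δ := A) (K := K) (ε := 0)
    (f := fun r => A + K * ∫ z in (0:ℝ)..r, g z) (a := 0) (b := T)
    (fun r _ => (hder r).continuousAt.continuousWithinAt)
    (fun r _ => (hder r).hasDerivWithinAt) (by simp [abs_of_nonneg hA])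
    (fun r hr => by
      have hr' : r ∈ Icc 0 T := ⟨hr.1, hr.2.le⟩
      have h1 : 0 ≤ g r := by rw [hgu r hr']; exact hu0 r hr'
      rw [add_zero, norm_mul, Real.norm_of_nonneg hK, Real.norm_of_nonneg h1]
      refine mul_le_mul_of_nonneg_left ?_ hK
      rw [hgu r hr']
      exact (hle r hr').trans (Real.le_norm_self _)) t ht
  rw [gronwallBound_ε0, sub_zero] at key
  exact (hle t ht).trans ((Real.le_norm_self _).trans key)

section Drift

variable {d : ℕ} {T Cb CDb : ℝ} {b : ℝ → Euc d → Euc d} {p q X Y : ℝ → Euc d} {x : Euc d}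

lemma integrableOn_drift (hb : Measurable (uncurry b))
    (hCb : ∀ t ∈ Icc (0:ℝ) T, ∀ x : Euc d, ‖b t x‖ ≤ Cb) (hp : ContinuousOn p (Icc 0 T)) :
    IntegrableOn (fun r => b r (p r)) (Icc 0 T) := by
  have hm : AEMeasurable p (volume.restrict (Icc 0 T)) := hp.aemeasurable measurableSet_Icc
  have hm2 : AEMeasurable (fun r => b r (p r)) (volume.restrict (Icc 0 T)) :=
    hb.comp_aemeasurable (aemeasurable_id.prodMk hm)
  refine Integrable.of_bound hm2.aestronglyMeasurable Cb ?_
  filter_upwards [ae_restrict_mem measurableSet_Icc] with r hr using hCb r hr _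

lemma intervalIntegrable_drift (hb : Measurable (uncurry b))
    (hCb : ∀ t ∈ Icc (0:ℝ) T, ∀ x : Euc d, ‖b t x‖ ≤ Cb) (hp : ContinuousOn p (Icc 0 T))
    {s t : ℝ} (hs : s ∈ Icc 0 T) (ht : t ∈ Icc 0 T) :
    IntervalIntegrable (fun r => b r (p r)) volume s t :=
  ((integrableOn_drift hb hCb hp).mono_set (uIcc_subset_Icc hs ht)).intervalIntegrable

lemma path_sub_eq_integral_add (hb : Measurable (uncurry b))
    (hCb : ∀ t ∈ Icc (0:ℝ) T, ∀ x : Euc d, ‖b t x‖ ≤ Cb) (hp : ContinuousOn p (Icc 0 T))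
    (hpe : ∀ t ∈ Icc 0 T, p t = x + (∫ r in (0:ℝ)..t, b r (p r)) + X t)
    {s t : ℝ} (hs : s ∈ Icc 0 T) (ht : t ∈ Icc 0 T) :
    p t - p s = (∫ r in s..t, b r (p r)) + (X t - X s) := by
  have h0 : (0:ℝ) ∈ Icc 0 T := ⟨le_rfl, hs.1.trans hs.2⟩
  rw [hpe t ht, hpe s hs, ← intervalIntegral.integral_interval_sub_left
    (intervalIntegrable_drift hb hCb hp h0 ht) (intervalIntegrable_drift hb hCb hp h0 hs)]
  abel

lemma norm_integral_drift_le
    (hCb : ∀ t ∈ Icc (0:ℝ) T, ∀ x : Euc d, ‖b t x‖ ≤ Cb)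
    {s t : ℝ} (hs : s ∈ Icc 0 T) (ht : t ∈ Icc 0 T) :
    ‖∫ r in s..t, b r (p r)‖ ≤ Cb * |t - s| :=
  intervalIntegral.norm_integral_le_of_norm_le_const fun r hr =>
    hCb r (uIcc_subset_Icc hs ht (uIoc_subset_uIcc hr)) _

lemma norm_drift_sub_le (hb1 : ∀ t ∈ Icc (0:ℝ) T, ContDiff ℝ 1 (b t))
    (hCDb : ∀ t ∈ Icc (0:ℝ) T, ∀ x : Euc d, ‖fderiv ℝ (b t) x‖ ≤ CDb)
    {t : ℝ} (ht : t ∈ Icc 0 T) (y z : Euc d) : ‖b t y - b t z‖ ≤ CDb * ‖y - z‖ :=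
  convex_univ.norm_image_sub_le_of_norm_fderiv_le
    (fun w _ => (hb1 t ht).differentiable (by norm_num) w) (fun w _ => hCDb t ht w)
    (mem_univ z) (mem_univ y)

lemma norm_integral_drift_sub_le (hb : Measurable (uncurry b))
    (hb1 : ∀ t ∈ Icc (0:ℝ) T, ContDiff ℝ 1 (b t))
    (hCb : ∀ t ∈ Icc (0:ℝ) T, ∀ x : Euc d, ‖b t x‖ ≤ Cb)
    (hCDb : ∀ t ∈ Icc (0:ℝ) T, ∀ x : Euc d, ‖fderiv ℝ (b t) x‖ ≤ CDb) (hCDb0 : 0 ≤ CDb)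
    (hp : ContinuousOn p (Icc 0 T)) (hq : ContinuousOn q (Icc 0 T)) {D : ℝ}
    (hD : ∀ t ∈ Icc 0 T, ‖p t - q t‖ ≤ D) {s t : ℝ} (hs : s ∈ Icc 0 T) (ht : t ∈ Icc 0 T) :
    ‖(∫ r in s..t, b r (p r)) - ∫ r in s..t, b r (q r)‖ ≤ CDb * D * |t - s| := by
  rw [← intervalIntegral.integral_sub (intervalIntegrable_drift hb hCb hp hs ht)
    (intervalIntegrable_drift hb hCb hq hs ht)]
  refine intervalIntegral.norm_integral_le_of_norm_le_const fun r hr => ?_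
  have hr' := uIcc_subset_Icc hs ht (uIoc_subset_uIcc hr)
  exact (norm_drift_sub_le hb1 hCDb hr' _ _).trans (mul_le_mul_of_nonneg_left (hD r hr') hCDb0)

/-- Stability of the perturbed ODE with respect to the driving path, in uniform norm. -/
lemma norm_path_sub_path_le (hb : Measurable (uncurry b))
    (hb1 : ∀ t ∈ Icc (0:ℝ) T, ContDiff ℝ 1 (b t))
    (hCb : ∀ t ∈ Icc (0:ℝ) T, ∀ x : Euc d, ‖b t x‖ ≤ Cb)
    (hCDb : ∀ t ∈ Icc (0:ℝ) T, ∀ x : Euc d, ‖fderiv ℝ (b t) x‖ ≤ CDb) (hCDb0 : 0 ≤ CDb)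
    (hp : ContinuousOn p (Icc 0 T)) (hq : ContinuousOn q (Icc 0 T))
    (hpe : ∀ t ∈ Icc 0 T, p t = x + (∫ r in (0:ℝ)..t, b r (p r)) + X t)
    (hqe : ∀ t ∈ Icc 0 T, q t = x + (∫ r in (0:ℝ)..t, b r (q r)) + Y t)
    {A : ℝ} (hA0 : 0 ≤ A) (hA : ∀ t ∈ Icc 0 T, ‖X t - Y t‖ ≤ A) :
    ∀ t ∈ Icc 0 T, ‖p t - q t‖ ≤ A * Real.exp (CDb * T) := by
  intro t ht
  have hc : ContinuousOn (fun r => ‖p r - q r‖) (Icc 0 T) := (hp.sub hq).norm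
  refine (le_mul_exp_of_le_add_integral hA0 hCDb0 hc (fun r _ => norm_nonneg _)
    (fun r hr => ?_) t ht).trans ?_
  · have h0 : (0:ℝ) ∈ Icc 0 T := ⟨le_rfl, hr.1.trans hr.2⟩
    have hsub := uIcc_subset_Icc h0 hr
    have e : p r - q r = (X r - Y r) + ∫ z in (0:ℝ)..r, (b z (p z) - b z (q z)) := by
      rw [intervalIntegral.integral_sub (intervalIntegrable_drift hb hCb hp h0 hr)
        (intervalIntegrable_drift hb hCb hq h0 hr), hpe r hr, hqe r hr]
      abel
    rw [e]
    refine (norm_add_le _ _).trans (add_le_add (hA r hr) ?_)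
    rw [← intervalIntegral.integral_const_mul]
    refine intervalIntegral.norm_integral_le_of_norm_le hr.1 ?_
      ((hc.mono hsub).intervalIntegrable.const_mul CDb)
    refine Filter.Eventually.of_forall fun z hz => norm_drift_sub_le hb1 hCDb ?_ _ _
    exact ⟨hz.1.le, hz.2.trans hr.2⟩
  · have := ht.2
    gcongr

end Drift

/-- The uniform Lipschitz constant of the solution map `X ↦ Φ^X`. -/
def supConst (γ T CDb : ℝ) : ℝ := T ^ γ * Real.exp (CDb * T)

/-- The `γ`-Hölder Lipschitz constant of the solution map `X ↦ Φ^X`. -/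
def holderConst (γ T CDb : ℝ) : ℝ := 1 + CDb * supConst γ T CDb * T ^ (1 - γ)

/-- The constant bounding the `γ`-Hölder seminorm of `Φ^X` relative to `1 + ‖X‖_γ`. -/
def growthConst (γ T Cb : ℝ) : ℝ := 1 + Cb * T ^ (1 - γ)

/-- The constant in the comparison of Gubinelli derivatives and remainders. -/
def comparisonConst (γ T Cb CDb M1 M2 M3 : ℝ) : ℝ :=
  M2 * holderConst γ T CDb + 2 * M3 * growthConst γ T Cb * supConst γ T CDb
    + ((M2 * Cb + M1 * CDb) * supConst γ T CDb * T ^ (1 - 2 * γ)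
      + 2 * M2 * holderConst γ T CDb * growthConst γ T Cb
      + 2 * M3 * growthConst γ T Cb ^ 2 * supConst γ T CDb)

lemma supConst_nonneg {γ T CDb : ℝ} (hT : 0 ≤ T) : 0 ≤ supConst γ T CDb := by
  unfold supConst; positivity

lemma holderConst_nonneg {γ T CDb : ℝ} (hT : 0 ≤ T) (h : 0 ≤ CDb) : 0 ≤ holderConst γ T CDb := by
  have := supConst_nonneg (γ := γ) (CDb := CDb) hT
  unfold holderConst; positivity

lemma growthConst_nonneg {γ T Cb : ℝ} (hT : 0 ≤ T) (h : 0 ≤ Cb) : 0 ≤ growthConst γ T Cb := by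
  unfold growthConst; positivity

lemma supConst_mono {γ T T' K K' : ℝ} (hγ : 0 ≤ γ) (hT : 0 ≤ T) (hK : 0 ≤ K) (h1 : T ≤ T')
    (h2 : K ≤ K') : supConst γ T K ≤ supConst γ T' K' := by
  have := hT.trans h1
  have := hK.trans h2
  unfold supConst; gcongr

lemma comparisonConst_mono {γ T T' B B' K K' M1 M1' M2 M2' M3 M3' : ℝ} (hγ : 0 ≤ γ)
    (hγ' : γ ≤ 1 / 2) (hT : 0 ≤ T) (hB : 0 ≤ B) (hK : 0 ≤ K) (hM1 : 0 ≤ M1) (hM2 : 0 ≤ M2)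
    (hM3 : 0 ≤ M3) (h1 : T ≤ T') (h2 : B ≤ B') (h3 : K ≤ K') (h4 : M1 ≤ M1') (h5 : M2 ≤ M2')
    (h6 : M3 ≤ M3') : comparisonConst γ T B K M1 M2 M3 ≤ comparisonConst γ T' B' K' M1' M2' M3' := by
  have hS0 := supConst_nonneg (γ := γ) (CDb := K) hT
  have hL0 := holderConst_nonneg (γ := γ) hT hK
  have hG0 := growthConst_nonneg (γ := γ) hT hB
  have hS := supConst_mono hγ hT hK h1 h3
  have e1 : 0 ≤ 1 - γ := by linarith
  have e2 : 0 ≤ 1 - 2 * γ := by linarith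
  have hL : holderConst γ T K ≤ holderConst γ T' K' := by
    have := hS0.trans hS
    have := hK.trans h3
    unfold holderConst; gcongr
  have hG : growthConst γ T B ≤ growthConst γ T' B' := by
    have := hB.trans h2
    unfold growthConst; gcongr
  have := hS0.trans hS
  have := hL0.trans hL
  have := hG0.trans hG
  have := hK.trans h3
  have := hB.trans h2
  have := hM1.trans h4
  have := hM2.trans h5
  have := hM3.trans h6
  have := hT.trans h1
  unfold comparisonConst
  gcongr

set_option maxHeartbeats 1000000 in
/-- Comparison of the controlled paths obtained by composing `φ` with the solutions `p` and `q`
driven by `X` and `Y`. -/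
lemma controlled_path_comparison {d : ℕ} {γ T Cb CDb M1 M2 M3 CX CY CXY : ℝ}
    (hγ0 : 0 < γ) (hγ1 : γ ≤ 1 / 2) (hT : 0 < T) {b : ℝ → Euc d → Euc d}
    {X Y p q : ℝ → Euc d} {x : Euc d} {φ : Euc d → ℝ}
    (hb : Measurable (uncurry b)) (hb1 : ∀ t ∈ Icc (0:ℝ) T, ContDiff ℝ 1 (b t))
    (hCb : ∀ t ∈ Icc (0:ℝ) T, ∀ x : Euc d, ‖b t x‖ ≤ Cb)
    (hCDb : ∀ t ∈ Icc (0:ℝ) T, ∀ x : Euc d, ‖fderiv ℝ (b t) x‖ ≤ CDb)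
    (hX0 : X 0 = 0) (hY0 : Y 0 = 0)
    (hX : ∀ s ∈ Icc (0:ℝ) T, ∀ t ∈ Icc (0:ℝ) T, ‖X t - X s‖ ≤ CX * |t - s| ^ γ)
    (hY : ∀ s ∈ Icc (0:ℝ) T, ∀ t ∈ Icc (0:ℝ) T, ‖Y t - Y s‖ ≤ CY * |t - s| ^ γ)
    (hXY : ∀ s ∈ Icc (0:ℝ) T, ∀ t ∈ Icc (0:ℝ) T,
      ‖(X t - Y t) - (X s - Y s)‖ ≤ CXY * |t - s| ^ γ)
    (hp : ContinuousOn p (Icc 0 T)) (hq : ContinuousOn q (Icc 0 T))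
    (hpe : ∀ t ∈ Icc 0 T, p t = x + (∫ r in (0:ℝ)..t, b r (p r)) + X t)
    (hqe : ∀ t ∈ Icc 0 T, q t = x + (∫ r in (0:ℝ)..t, b r (q r)) + Y t)
    (hf : Differentiable ℝ φ) (hf' : Differentiable ℝ (fderiv ℝ φ))
    (hM1 : ∀ x, ‖fderiv ℝ φ x‖ ≤ M1) (hM2 : ∀ x, ‖fderiv ℝ (fderiv ℝ φ) x‖ ≤ M2)
    (hM3 : ∀ x y, ‖fderiv ℝ (fderiv ℝ φ) x - fderiv ℝ (fderiv ℝ φ) y‖ ≤ M3 * ‖x - y‖)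
    (hCb0 : 0 ≤ Cb) (hCDb0 : 0 ≤ CDb) (hM10 : 0 ≤ M1) (hM20 : 0 ≤ M2) (hM30 : 0 ≤ M3)
    (hCX0 : 0 ≤ CX) (hCY0 : 0 ≤ CY) (hCXY0 : 0 ≤ CXY)
    {s t : ℝ} (hs : s ∈ Icc 0 T) (ht : t ∈ Icc 0 T) :
    ‖(fderiv ℝ φ (p t) - fderiv ℝ φ (q t)) - (fderiv ℝ φ (p s) - fderiv ℝ φ (q s))‖ ≤
        comparisonConst γ T Cb CDb M1 M2 M3 * CXY * (1 + CX) * (1 + CY) * |t - s| ^ γ ∧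
      ‖(φ (p t) - φ (p s) - fderiv ℝ φ (p s) (X t - X s)) -
          (φ (q t) - φ (q s) - fderiv ℝ φ (q s) (Y t - Y s))‖ ≤
        comparisonConst γ T Cb CDb M1 M2 M3 * CXY * (1 + CX) * (1 + CY) * |t - s| ^ (2 * γ) := by
  have hdT : |t - s| ≤ T := by
    rw [abs_le]; constructor <;> linarith [hs.1, hs.2, ht.1, ht.2]
  have split : ∀ β : ℝ, 0 ≤ β → β ≤ 1 → |t - s| ≤ T ^ (1 - β) * |t - s| ^ β := fun β h0 h1 => by
    calc |t - s| = |t - s| ^ (1 - β) * |t - s| ^ β := by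
          rw [← Real.rpow_add_of_nonneg (abs_nonneg _) (by linarith) h0]; simp
      _ ≤ _ := by
          have : 0 ≤ 1 - β := by linarith
          gcongr
  set δ := |t - s| with hδ
  have hδ0 : 0 ≤ δ := abs_nonneg _
  have hsq : δ ^ (2 * γ) = δ ^ γ * δ ^ γ := by
    rw [← Real.rpow_add_of_nonneg hδ0 hγ0.le hγ0.le]; ring_nf
  have hd1 := split γ hγ0.le (by linarith)
  have hd2 := split (2 * γ) (by linarith) (by linarith)
  have hS0 := supConst_nonneg (γ := γ) (CDb := CDb) hT.le
  have hL0 := holderConst_nonneg (γ := γ) hT.le hCDb0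
  have hG0 := growthConst_nonneg (γ := γ) hT.le hCb0
  set S := supConst γ T CDb with hS
  set L := holderConst γ T CDb with hL
  set G := growthConst γ T Cb with hG
  set w := δ ^ γ with hw
  have hw0 : 0 ≤ w := Real.rpow_nonneg hδ0 _
  set V := T ^ (1 - 2 * γ) with hV
  have hV0 : 0 ≤ V := Real.rpow_nonneg hT.le _
  have hsup : ∀ r ∈ Icc 0 T, ‖p r - q r‖ ≤ CXY * S := by
    intro r hr
    refine (norm_path_sub_path_le hb hb1 hCb hCDb hCDb0 hp hq hpe hqe
      (A := CXY * T ^ γ) (by positivity) (fun z hz => ?_) r hr).trans_eq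
      (by rw [hS, supConst]; ring)
    have := hXY 0 ⟨le_rfl, hT.le⟩ z hz
    rw [hX0, hY0, sub_zero, sub_zero, sub_zero, abs_of_nonneg hz.1] at this
    refine this.trans ?_
    have h1 := hz.1
    have h2 := hz.2
    gcongr
  have hpt := path_sub_eq_integral_add hb hCb hp hpe hs ht
  have hqt := path_sub_eq_integral_add hb hCb hq hqe hs ht
  have hI : ‖∫ r in s..t, b r (p r)‖ ≤ Cb * δ := norm_integral_drift_le hCb hs ht
  have hJ : ‖∫ r in s..t, b r (q r)‖ ≤ Cb * δ := norm_integral_drift_le hCb hs ht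
  have hIJ := norm_integral_drift_sub_le hb hb1 hCb hCDb hCDb0 hp hq hsup hs ht
  rw [← hδ] at hIJ
  set I := ∫ r in s..t, b r (p r)
  set J := ∫ r in s..t, b r (q r)
  have growth : ∀ {I Z : Euc d} {c : ℝ}, 0 ≤ c → ‖I‖ ≤ Cb * δ → ‖Z‖ ≤ c * w →
      ‖I + Z‖ ≤ G * (1 + c) * w := by
    intro I Z c hc h1 h2
    have h3 : Cb * δ ≤ Cb * T ^ (1 - γ) * w := by
      rw [mul_assoc]; exact mul_le_mul_of_nonneg_left hd1 hCb0
    have h4 : 0 ≤ Cb * T ^ (1 - γ) := by positivity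
    have h5 : G * (1 + c) * w = Cb * T ^ (1 - γ) * w + c * w
        + (w + Cb * T ^ (1 - γ) * c * w) := by rw [hG, growthConst]; ring
    have : 0 ≤ w + Cb * T ^ (1 - γ) * c * w := by positivity
    linarith [norm_add_le I Z]
  have hh : ‖p t - p s‖ ≤ G * (1 + CX) * w := by
    rw [hpt]; exact growth hCX0 hI (hX s hs t ht)
  have hk : ‖q t - q s‖ ≤ G * (1 + CY) * w := by
    rw [hqt]; exact growth hCY0 hJ (hY s hs t ht)
  have hhk : ‖(p t - p s) - (q t - q s)‖ ≤ L * CXY * w := by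
    have e : (p t - p s) - (q t - q s) = (I - J) + ((X t - Y t) - (X s - Y s)) := by
      rw [hpt, hqt]; abel
    rw [e]
    have h3 : CDb * (CXY * S) * δ ≤ CDb * (CXY * S) * (T ^ (1 - γ) * w) :=
      mul_le_mul_of_nonneg_left hd1 (by positivity)
    have h5 : L * CXY * w = CDb * (CXY * S) * (T ^ (1 - γ) * w) + CXY * w := by
      rw [hL, holderConst]; ring
    linarith [norm_add_le (I - J) ((X t - Y t) - (X s - Y s)), hXY s hs t ht]
  have hsum : (1 + CX) + (1 + CY) ≤ 2 * ((1 + CX) * (1 + CY)) := by nlinarith [mul_nonneg hCX0 hCY0]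
  have hone : 1 ≤ (1 + CX) * (1 + CY) := by nlinarith [mul_nonneg hCX0 hCY0]
  have hhs : ‖p t - p s‖ + ‖q t - q s‖ ≤ G * (2 * ((1 + CX) * (1 + CY))) * w := by
    have := mul_le_mul_of_nonneg_left hsum (mul_nonneg hG0 hw0)
    linarith
  set Q := (1 + CX) * (1 + CY) with hQ
  have hQ0 : 0 ≤ Q := by linarith
  have hconst : comparisonConst γ T Cb CDb M1 M2 M3 * CXY * (1 + CX) * (1 + CY) =
      (M2 * L + 2 * M3 * G * S + ((M2 * Cb + M1 * CDb) * S * V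
        + 2 * M2 * L * G + 2 * M3 * G ^ 2 * S)) * CXY * Q := by
    rw [comparisonConst, hQ]; ring
  rw [hconst, hsq]
  constructor
  · calc _ ≤ M2 * ‖(p t - p s) - (q t - q s)‖
          + M3 * (‖p t - p s‖ + ‖q t - q s‖) * ‖p s - q s‖ :=
        norm_sub_sub_sub_le_of_lipschitz_fderiv hf' hM2 hM3 hM30 _ _ _ _
      _ ≤ M2 * (L * CXY * w) + M3 * (G * (2 * Q) * w) * (CXY * S) := by
        gcongr
        exact hsup s hs
      _ ≤ M2 * (L * CXY * w) * Q + M3 * (G * (2 * Q) * w) * (CXY * S)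
          + ((M2 * Cb + M1 * CDb) * S * V + 2 * M2 * L * G + 2 * M3 * G ^ 2 * S) * CXY * Q * w := by
        have h1 : M2 * (L * CXY * w) ≤ M2 * (L * CXY * w) * Q :=
          le_mul_of_one_le_right (by positivity) hone
        have h2 : 0 ≤ ((M2 * Cb + M1 * CDb) * S * V + 2 * M2 * L * G + 2 * M3 * G ^ 2 * S)
          * CXY * Q * w := by positivity
        linarith
      _ = _ := by ring
  · have hlip : ‖fderiv ℝ φ (p s) - fderiv ℝ φ (q s)‖ ≤ M2 * (CXY * S) :=
      (convex_univ.norm_image_sub_le_of_norm_fderiv_le (fun z _ => hf' z) (fun z _ => hM2 z)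
        (mem_univ (q s)) (mem_univ (p s))).trans (mul_le_mul_of_nonneg_left (hsup s hs) hM20)
    have e : (φ (p t) - φ (p s) - fderiv ℝ φ (p s) (X t - X s)) -
          (φ (q t) - φ (q s) - fderiv ℝ φ (q s) (Y t - Y s)) =
        ((φ (p s + (p t - p s)) - φ (p s) - fderiv ℝ φ (p s) (p t - p s)) -
          (φ (q s + (q t - q s)) - φ (q s) - fderiv ℝ φ (q s) (q t - q s)))
        + (fderiv ℝ φ (p s) - fderiv ℝ φ (q s)) I + fderiv ℝ φ (q s) (I - J) := by
      rw [add_sub_cancel, add_sub_cancel, hpt, hqt]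
      simp only [map_add, map_sub, sub_apply]
      ring
    rw [hsq] at hd2
    rw [e]
    calc
      _ ≤ (M2 * ‖(p t - p s) - (q t - q s)‖ * (‖p t - p s‖ + ‖q t - q s‖)
          + 2 * M3 * ‖p s - q s‖ * (‖p t - p s‖ * ‖q t - q s‖))
          + M2 * (CXY * S) * (Cb * δ) + M1 * (CDb * (CXY * S) * δ) := by
        refine (norm_add₃_le).trans (add_le_add (add_le_add
          (norm_taylor_sub_taylor_le hf hf' hM2 hM3 hM20 hM30 _ _ _ _) ?_) ?_)
        · exact (ContinuousLinearMap.le_opNorm _ _).trans (by gcongr)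
        · exact (ContinuousLinearMap.le_opNorm _ _).trans (by gcongr; exact hM1 _)
      _ ≤ (M2 * (L * CXY * w) * (G * (2 * Q) * w)
          + 2 * M3 * (CXY * S) * ((G * (1 + CX) * w) * (G * (1 + CY) * w)))
          + M2 * (CXY * S) * (Cb * (V * (w * w))) + M1 * (CDb * (CXY * S) * (V * (w * w))) := by
        gcongr
        exact hsup s hs
      _ = (2 * M2 * L * G + 2 * M3 * G ^ 2 * S) * CXY * Q * (w * w)
          + (M2 * Cb + M1 * CDb) * S * V * CXY * (w * w) := by rw [hQ]; ring
      _ ≤ (2 * M2 * L * G + 2 * M3 * G ^ 2 * S) * CXY * Q * (w * w)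
          + (M2 * Cb + M1 * CDb) * S * V * CXY * (w * w) * Q
          + (M2 * L + 2 * M3 * G * S) * CXY * Q * (w * w) := by
        have h1 : (M2 * Cb + M1 * CDb) * S * V * CXY * (w * w) ≤
            (M2 * Cb + M1 * CDb) * S * V * CXY * (w * w) * Q :=
          le_mul_of_one_le_right (by positivity) hone
        have h2 : 0 ≤ (M2 * L + 2 * M3 * G * S) * CXY * Q * (w * w) := by positivity
        linarith
      _ = _ := by ring

/-- A radius outside of which the solution never meets the ball of radius `Rφ`. -/
lemma lt_norm_path {d : ℕ} {γ T Cb CX Rφ : ℝ} (hγ0 : 0 ≤ γ) {b : ℝ → Euc d → Euc d}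
    {X p : ℝ → Euc d} {x : Euc d} (hCX0 : 0 ≤ CX) (hCb0 : 0 ≤ Cb)
    (hCb : ∀ t ∈ Icc (0:ℝ) T, ∀ x : Euc d, ‖b t x‖ ≤ Cb) (hX0 : X 0 = 0)
    (hX : ∀ s ∈ Icc (0:ℝ) T, ∀ t ∈ Icc (0:ℝ) T, ‖X t - X s‖ ≤ CX * |t - s| ^ γ)
    (hpe : ∀ t ∈ Icc 0 T, p t = x + (∫ r in (0:ℝ)..t, b r (p r)) + X t)
    (hx : Rφ + Cb * T + CX * T ^ γ < ‖x‖) {t : ℝ} (ht : t ∈ Icc 0 T) : Rφ < ‖p t‖ := by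
  have h0 : (0:ℝ) ∈ Icc 0 T := ⟨le_rfl, ht.1.trans ht.2⟩
  have h1 : ‖∫ r in (0:ℝ)..t, b r (p r)‖ ≤ Cb * |t - 0| := norm_integral_drift_le hCb h0 ht
  have h2 := hX 0 h0 t ht
  rw [sub_zero, abs_of_nonneg ht.1] at h1 h2
  rw [hX0, sub_zero] at h2
  have h3 : Cb * t ≤ Cb * T := mul_le_mul_of_nonneg_left ht.2 hCb0
  have h4 : CX * t ^ γ ≤ CX * T ^ γ :=
    mul_le_mul_of_nonneg_left (Real.rpow_le_rpow ht.1 ht.2 hγ0) hCX0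
  have e : x = p t - (∫ r in (0:ℝ)..t, b r (p r)) - X t := by rw [hpe t ht]; abel
  have h5 : ‖x‖ ≤ ‖p t‖ + ‖∫ r in (0:ℝ)..t, b r (p r)‖ + ‖X t‖ := by
    conv_lhs => rw [e]
    exact (norm_sub_le _ _).trans (add_le_add_left (norm_sub_le _ _) _)
  linarith

/-- comparison of the controlled paths `φ ∘ Φ^X` and `φ ∘ Φ^Y`,
Lemma `comparison_controlled`. For `b ∈ L^∞([0,T];C¹_b)`, `γ`-Hölder drivers `X, Y`
vanishing at `0` with flows `Φ^X, Φ^Y`, and `φ ∈ C³_c`, there are a constant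
`C = C(T, ‖b‖_∞, ‖Db‖_∞, ‖φ‖_∞, ‖Dφ‖_∞, ‖D²φ‖_∞, ‖D³φ‖_∞)` and a radius
`R = R(T, ‖b‖_∞, ‖X‖_γ, ‖Y‖_γ, Rφ)`, both nondecreasing in each argument, such that
the Gubinelli derivatives and remainders of the two controlled paths differ by at most
`C ‖X-Y‖_γ (1+‖X‖_γ)(1+‖Y‖_γ) 1_{B(0,R)}(x)` in the `γ`- resp. `2γ`-Hölder sense. -/
theorem stmt14 (d : ℕ) (γ : ℝ) (hγ0 : 1/3 < γ) (hγ1 : γ ≤ 1/2) :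
    ∃ C : ℝ → ℝ → ℝ → ℝ → ℝ → ℝ → ℝ → ℝ, ∃ R : ℝ → ℝ → ℝ → ℝ → ℝ → ℝ,
      (∀ a₁ a₂ b₁ b₂ c₁ c₂ d₁ d₂ e₁ e₂ f₁ f₂ g₁ g₂ : ℝ,
        a₁ ≤ a₂ → b₁ ≤ b₂ → c₁ ≤ c₂ → d₁ ≤ d₂ → e₁ ≤ e₂ → f₁ ≤ f₂ → g₁ ≤ g₂ →
        C a₁ b₁ c₁ d₁ e₁ f₁ g₁ ≤ C a₂ b₂ c₂ d₂ e₂ f₂ g₂) ∧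
      (∀ a₁ a₂ b₁ b₂ c₁ c₂ d₁ d₂ e₁ e₂ : ℝ,
        a₁ ≤ a₂ → b₁ ≤ b₂ → c₁ ≤ c₂ → d₁ ≤ d₂ → e₁ ≤ e₂ →
        R a₁ b₁ c₁ d₁ e₁ ≤ R a₂ b₂ c₂ d₂ e₂) ∧
      ∀ (T Cb CDb Mφ0 Mφ1 Mφ2 Mφ3 CX CY CXY Rφ : ℝ), 0 < T →
      ∀ (b : ℝ → Euc d → Euc d) (X Y : ℝ → Euc d) (ΦX ΦY : ℝ → Euc d → Euc d)
        (φ : Euc d → ℝ),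
        Measurable (Function.uncurry b) →
        (∀ t ∈ Icc (0:ℝ) T, ContDiff ℝ 1 (b t)) →
        (∀ t ∈ Icc (0:ℝ) T, ∀ x : Euc d, ‖b t x‖ ≤ Cb) →
        (∀ t ∈ Icc (0:ℝ) T, ∀ x : Euc d, ‖fderiv ℝ (b t) x‖ ≤ CDb) →
        X 0 = 0 → Y 0 = 0 →
        (∀ s ∈ Icc (0:ℝ) T, ∀ t ∈ Icc (0:ℝ) T, ‖X t - X s‖ ≤ CX * |t - s| ^ γ) →
        (∀ s ∈ Icc (0:ℝ) T, ∀ t ∈ Icc (0:ℝ) T, ‖Y t - Y s‖ ≤ CY * |t - s| ^ γ) →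
        (∀ s ∈ Icc (0:ℝ) T, ∀ t ∈ Icc (0:ℝ) T,
          ‖(X t - Y t) - (X s - Y s)‖ ≤ CXY * |t - s| ^ γ) →
        (∀ x : Euc d, ContinuousOn (fun t => ΦX t x) (Icc (0:ℝ) T)) →
        (∀ x : Euc d, ∀ t ∈ Icc (0:ℝ) T,
          ΦX t x = x + (∫ r in (0:ℝ)..t, b r (ΦX r x)) + X t) →
        (∀ x : Euc d, ContinuousOn (fun t => ΦY t x) (Icc (0:ℝ) T)) →
        (∀ x : Euc d, ∀ t ∈ Icc (0:ℝ) T,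
          ΦY t x = x + (∫ r in (0:ℝ)..t, b r (ΦY r x)) + Y t) →
        ContDiff ℝ 3 φ → HasCompactSupport φ →
        Function.support φ ⊆ Metric.closedBall (0 : Euc d) Rφ →
        (∀ x : Euc d, |φ x| ≤ Mφ0) →
        (∀ x : Euc d, ‖fderiv ℝ φ x‖ ≤ Mφ1) →
        (∀ x : Euc d, ‖iteratedFDeriv ℝ 2 φ x‖ ≤ Mφ2) →
        (∀ x : Euc d, ‖iteratedFDeriv ℝ 3 φ x‖ ≤ Mφ3) →
        ∀ x : Euc d,
          let B : ℝ := C T Cb CDb Mφ0 Mφ1 Mφ2 Mφ3 * CXY * (1 + CX) * (1 + CY) *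
            (if ‖x‖ ≤ R T Cb CX CY Rφ then (1:ℝ) else 0)
          ∀ s ∈ Icc (0:ℝ) T, ∀ t ∈ Icc (0:ℝ) T, s ≠ t →
            ‖(fderiv ℝ φ (ΦX t x) - fderiv ℝ φ (ΦY t x)) -
              (fderiv ℝ φ (ΦX s x) - fderiv ℝ φ (ΦY s x))‖ ≤ B * |t - s| ^ γ ∧
            ‖(φ (ΦX t x) - φ (ΦX s x) - fderiv ℝ φ (ΦX s x) (X t - X s)) -
              (φ (ΦY t x) - φ (ΦY s x) - fderiv ℝ φ (ΦY s x) (Y t - Y s))‖ ≤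
              B * |t - s| ^ (2 * γ) := by
  have hγ : 0 < γ := by linarith
  refine ⟨fun T B K _ M1 M2 M3 => comparisonConst γ (max T 0) (max B 0) (max K 0) (max M1 0)
      (max M2 0) (max M3 0),
    fun T B CX CY ρ => ρ + max B 0 * max T 0 + (max CX 0 + max CY 0) * max T 0 ^ γ, ?_, ?_, ?_⟩
  · intro a₁ a₂ b₁ b₂ c₁ c₂ d₁ d₂ e₁ e₂ f₁ f₂ g₁ g₂ ha hb hc _ he hf hg
    apply comparisonConst_mono hγ.le hγ1 <;>
      first | exact le_max_right _ _ | exact max_le_max_right 0 (by assumption)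
  · intro a₁ a₂ b₁ b₂ c₁ c₂ d₁ d₂ e₁ e₂ ha hb hc hd he
    have h : ∀ z : ℝ, 0 ≤ max z 0 := fun z => le_max_right _ _
    have := h a₁
    have := h a₂
    have := h b₁
    have := h b₂
    have := h c₁
    have := h c₂
    have := h d₁
    have := h d₂
    dsimp only
    gcongr
  intro T Cb CDb Mφ0 Mφ1 Mφ2 Mφ3 CX CY CXY Rφ hT b X Y ΦX ΦY φ hb hb1 hCb hCDb hX0 hY0 hX hY hXY
    hpc hpe hqc hqe hφ _ hsupp _ hM1 hM2 hM3 x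
  have h0 : (0:ℝ) ∈ Icc 0 T := ⟨le_rfl, hT.le⟩
  have hTT : T ∈ Icc 0 T := ⟨hT.le, le_rfl⟩
  have hCb0 : 0 ≤ Cb := (norm_nonneg _).trans (hCb 0 h0 0)
  have hCDb0 : 0 ≤ CDb := (norm_nonneg _).trans (hCDb 0 h0 0)
  have hM10 : 0 ≤ Mφ1 := (norm_nonneg _).trans (hM1 0)
  have hM20 : 0 ≤ Mφ2 := (norm_nonneg _).trans (hM2 0)
  have hM30 : 0 ≤ Mφ3 := (norm_nonneg _).trans (hM3 0)
  have hpos : 0 < |T - 0| ^ γ := by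
    rw [sub_zero, abs_of_pos hT]; exact Real.rpow_pos_of_pos hT _
  have hCX0 : 0 ≤ CX := nonneg_of_mul_nonneg_left ((norm_nonneg _).trans (hX 0 h0 T hTT)) hpos
  have hCY0 : 0 ≤ CY := nonneg_of_mul_nonneg_left ((norm_nonneg _).trans (hY 0 h0 T hTT)) hpos
  have hCXY0 : 0 ≤ CXY := nonneg_of_mul_nonneg_left ((norm_nonneg _).trans (hXY 0 h0 T hTT)) hpos
  simp only [max_eq_left hT.le, max_eq_left hCb0, max_eq_left hCDb0, max_eq_left hM10,
    max_eq_left hM20, max_eq_left hM30, max_eq_left hCX0, max_eq_left hCY0]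
  intro s hs t ht _
  split_ifs with hx
  · have hD1 : ContDiff ℝ 2 (fderiv ℝ φ) := hφ.fderiv_right (by norm_num)
    have hD2 : ContDiff ℝ 1 (fderiv ℝ (fderiv ℝ φ)) := hD1.fderiv_right (by norm_num)
    have hM2' : ∀ y, ‖fderiv ℝ (fderiv ℝ φ) y‖ ≤ Mφ2 := fun y => by
      rw [← norm_iteratedFDeriv_one, norm_iteratedFDeriv_fderiv]
      exact hM2 y
    have hM3' : ∀ y, ‖iteratedFDeriv ℝ 1 (fderiv ℝ (fderiv ℝ φ)) y‖ ≤ Mφ3 := fun y => by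
      rw [norm_iteratedFDeriv_fderiv, norm_iteratedFDeriv_fderiv]
      exact hM3 y
    rw [mul_one]
    exact controlled_path_comparison hγ hγ1 hT hb hb1 hCb hCDb hX0 hY0 hX hY hXY (hpc x) (hqc x)
      (hpe x) (hqe x) (hφ.differentiable (by norm_num)) (hD1.differentiable (by norm_num)) hM1 hM2'
      (norm_sub_le_of_norm_iteratedFDeriv_one_le hD2 hM3')
      hCb0 hCDb0 hM10 hM20 hM30 hCX0 hCY0 hCXY0 hs ht
  · have hTγ : 0 ≤ T ^ γ := Real.rpow_nonneg hT.le _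
    have h1 := mul_nonneg hCX0 hTγ
    have h2 := mul_nonneg hCY0 hTγ
    have hpn : ∀ r ∈ Icc 0 T, Rφ < ‖ΦX r x‖ := fun r hr =>
      lt_norm_path hγ.le hCX0 hCb0 hCb hX0 hX (hpe x) (by linarith) hr
    have hqn : ∀ r ∈ Icc 0 T, Rφ < ‖ΦY r x‖ := fun r hr =>
      lt_norm_path hγ.le hCY0 hCb0 hCb hY0 hY (hqe x) (by linarith) hr
    have htsupp : tsupport φ ⊆ Metric.closedBall 0 Rφ :=
      closure_minimal hsupp Metric.isClosed_closedBall
    have hz : ∀ y : Euc d, Rφ < ‖y‖ → y ∉ tsupport φ := fun y hy hmem => by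
      have := htsupp hmem
      rw [mem_closedBall_zero_iff] at this
      linarith
    have hφ0 : ∀ y : Euc d, Rφ < ‖y‖ → φ y = 0 := fun y hy =>
      image_eq_zero_of_notMem_tsupport (hz y hy)
    have hdφ0 : ∀ y : Euc d, Rφ < ‖y‖ → fderiv ℝ φ y = 0 := fun y hy =>
      image_eq_zero_of_notMem_tsupport fun h => hz y hy (tsupport_fderiv_subset ℝ h)
    rw [hdφ0 _ (hpn s hs), hdφ0 _ (hpn t ht), hdφ0 _ (hqn s hs), hdφ0 _ (hqn t ht),
      hφ0 _ (hpn s hs), hφ0 _ (hpn t ht), hφ0 _ (hqn s hs), hφ0 _ (hqn t ht)]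
    simp
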